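/- A residuated lattice A has the Boolean Lifting Property if and only if for any two distinct maximal filters M and N of A there exists e ∈ B(A) such that e ∈ M and ¬e ∈ N. -/

import Mathlib

/-- A (commutative integral bounded) residuated lattice: a bounded lattice together
with a commutative monoid structure (whose unit is the top element) and a residuum
operation satisfying the law of residuation. -/
class ResiduatedLattice (A : Type*) extends Lattice A, BoundedOrder A, CommMonoid A where
  rimp : A → A → A
  residuation : ∀ a b c : A, a ≤ rimp b c ↔ a * b ≤ c
  one_eq_top : (1 : A) = ⊤

namespace ResiduatedLattice

variable {A : Type*} [ResiduatedLattice A]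

/-- Negation: ¬a = a → 0. -/
def rneg (a : A) : A := rimp a ⊥

/-- Biresiduum: d(a,b) = (a → b) ∧ (b → a). -/
def bires (a b : A) : A := rimp a b ⊓ rimp b a

/-- Membership in the Boolean center B(A): complemented elements of the bounded lattice. -/
def IsBoolElem (e : A) : Prop := ∃ f : A, e ⊔ f = ⊤ ∧ e ⊓ f = ⊥

/-- A filter of a residuated lattice. -/
def IsRLFilter (F : Set A) : Prop :=
  F.Nonempty ∧ (∀ a b : A, a ∈ F → b ∈ F → a * b ∈ F) ∧ (∀ a b : A, a ∈ F → a ≤ b → b ∈ F)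

/-- The principal filter [x) = {a | xⁿ ≤ a for some n ≥ 1}. -/
def princ (x : A) : Set A := {a : A | ∃ n : ℕ, 1 ≤ n ∧ x ^ n ≤ a}

/-- A filter F has the Boolean Lifting Property. -/
def HasBLP (F : Set A) : Prop :=
  ∀ a : A, a ⊔ rneg a ∈ F → ∃ e : A, IsBoolElem e ∧ bires a e ∈ F

/-- A filter F has the Idempotent Lifting Property. -/
def HasILP (F : Set A) : Prop :=
  ∀ a : A, bires a (a * a) ∈ F → ∃ e : A, e * e = e ∧ bires a e ∈ F

/-- A proper filter. -/
def IsProperRLFilter (F : Set A) : Prop := IsRLFilter F ∧ F ≠ Set.univ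

/-- A maximal filter: a proper filter maximal under inclusion among proper filters. -/
def IsMaxRLFilter (M : Set A) : Prop :=
  IsProperRLFilter M ∧ ∀ G : Set A, IsProperRLFilter G → M ⊆ G → G = M

/-- A prime filter: a proper filter P with a ∨ b ∈ P → a ∈ P or b ∈ P. -/
def IsPrimeRLFilter (P : Set A) : Prop :=
  IsProperRLFilter P ∧ ∀ a b : A, a ⊔ b ∈ P → a ∈ P ∨ b ∈ P

/-- The radical: intersection of all maximal filters. -/
def rad (A : Type*) [ResiduatedLattice A] : Set A :=
  {a : A | ∀ M : Set A, IsMaxRLFilter M → a ∈ M}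

/-- v(a) = set of maximal filters containing a. -/
def vset (a : A) : Set (Set A) := {M : Set A | IsMaxRLFilter M ∧ a ∈ M}

/-- d(a) = set of maximal filters not containing a. -/
def dset (a : A) : Set (Set A) := {M : Set A | IsMaxRLFilter M ∧ a ∉ M}

/-- An element is nilpotent iff some positive power of it is 0. -/
def RLNilpotent (a : A) : Prop := ∃ n : ℕ, 1 ≤ n ∧ a ^ n = ⊥

/-- The join F ∨ G of two filters: the smallest filter including F ∪ G. -/
def filtJoin (F G : Set A) : Set A := ⋂₀ {H : Set A | IsRLFilter H ∧ F ∪ G ⊆ H}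

end ResiduatedLattice


namespace ResiduatedLattice

variable {A : Type*} [ResiduatedLattice A]

theorem hx_mono {a b c d : A} (h : a ≤ c) (k : b ≤ d) : a * b ≤ c * d := by
  have h1 : a * b ≤ c * b :=
    (residuation a b _).1 (h.trans ((residuation c b _).2 le_rfl))
  have h2 : b * c ≤ d * c :=
    (residuation b c _).1 (k.trans ((residuation d c _).2 le_rfl))
  rw [mul_comm b c, mul_comm d c] at h2
  exact h1.trans h2

theorem hx_mul_sup (a b c : A) : a * (b ⊔ c) ≤ a * b ⊔ a * c := by
  rw [mul_comm, ← residuation]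
  refine sup_le ?_ ?_
  · rw [residuation, mul_comm]; exact le_sup_left
  · rw [residuation, mul_comm]; exact le_sup_right

theorem hx_le_one (a : A) : a ≤ 1 := by rw [one_eq_top]; exact le_top

theorem hx_mul_left (a b : A) : a * b ≤ a := by
  simpa using hx_mono (le_refl a) (hx_le_one b)

theorem hx_mul_right (a b : A) : a * b ≤ b := by
  simpa using hx_mono (hx_le_one a) (le_refl b)

theorem hx_mul_neg (a : A) : a * rneg a ≤ ⊥ := by
  rw [mul_comm, ← residuation]; exact le_rfl

theorem hx_le_neg {a b : A} (h : a * b ≤ ⊥) : a ≤ rneg b := (residuation _ _ _).2 h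

theorem hx_le_negneg (a : A) : a ≤ rneg (rneg a) := hx_le_neg (hx_mul_neg a)

theorem hx_bool_iff (e : A) : IsBoolElem e ↔ e ⊔ rneg e = ⊤ := by
  constructor
  · rintro ⟨f, h1, h2⟩
    rw [eq_top_iff, ← h1]
    refine sup_le_sup_left (hx_le_neg ?_) _
    rw [← h2]
    exact le_inf (hx_mul_right _ _) (hx_mul_left _ _)
  · intro h
    refine ⟨rneg e, h, ?_⟩
    rw [eq_bot_iff]
    have h1 : (e ⊓ rneg e) * (e ⊔ rneg e) = e ⊓ rneg e := by
      rw [h, ← one_eq_top, mul_one]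
    rw [← h1]
    refine (hx_mul_sup _ _ _).trans (sup_le ?_ ?_)
    · refine le_trans ?_ (hx_mul_neg e)
      rw [mul_comm]
      exact hx_mono le_rfl inf_le_right
    · exact le_trans (hx_mono inf_le_left le_rfl) (hx_mul_neg e)

/-- (x ⊔ y)(x' ⊔ z) ≤ x ⊔ x' ⊔ yz -/
theorem hx_sup_mul_sup (x y x' z : A) : (x ⊔ y) * (x' ⊔ z) ≤ (x ⊔ x') ⊔ y * z := by
  refine (hx_mul_sup _ _ _).trans (sup_le ?_ ?_)
  · exact (hx_mul_right _ _).trans (le_sup_right.trans le_sup_left)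
  · rw [mul_comm]
    refine (hx_mul_sup _ _ _).trans (sup_le ?_ ?_)
    · exact (hx_mul_right _ _).trans (le_sup_left.trans le_sup_left)
    · rw [mul_comm]; exact le_sup_right

theorem hx_negmul (e f : A) : rneg e * rneg f ≤ rneg (e ⊔ f) := by
  apply hx_le_neg
  refine (hx_mul_sup _ _ _).trans (sup_le ?_ ?_)
  · refine le_trans ?_ (hx_mul_neg e)
    rw [mul_comm e]
    exact hx_mono (hx_mul_left _ _) le_rfl
  · refine le_trans ?_ (hx_mul_neg f)
    rw [mul_comm f]
    exact hx_mono (hx_mul_right _ _) le_rfl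

theorem hx_bool_sup {e f : A} (he : IsBoolElem e) (hf : IsBoolElem f) : IsBoolElem (e ⊔ f) := by
  rw [hx_bool_iff] at *
  rw [eq_top_iff]
  have h := hx_sup_mul_sup e (rneg e) f (rneg f)
  rw [he, hf, ← one_eq_top, mul_one] at h
  rw [← one_eq_top]
  exact h.trans (sup_le_sup_left (hx_negmul e f) _)

theorem hx_bool_neg {e : A} (he : IsBoolElem e) : IsBoolElem (rneg e) := by
  rw [hx_bool_iff] at *
  rw [eq_top_iff, ← he]
  exact sup_le ((hx_le_negneg e).trans le_sup_right) le_sup_left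

theorem hx_one_mem {F : Set A} (hF : IsRLFilter F) : (1 : A) ∈ F := by
  obtain ⟨x, hx⟩ := hF.1
  exact hF.2.2 _ _ hx (hx_le_one x)

theorem hx_proper {F : Set A} (hF : IsRLFilter F) : F ≠ Set.univ ↔ (⊥ : A) ∉ F := by
  constructor
  · intro h hb
    exact h (Set.eq_univ_of_forall fun x => hF.2.2 _ _ hb bot_le)
  · rintro h rfl
    exact h trivial

theorem hx_exists_max {F : Set A} (hF : IsRLFilter F) (hb : (⊥ : A) ∉ F) :
    ∃ M : Set A, IsMaxRLFilter M ∧ F ⊆ M := by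
  obtain ⟨M, hFM, hM⟩ := zorn_subset_nonempty {G : Set A | IsProperRLFilter G} (by
    intro c hc hch hne
    have hfil : IsRLFilter (⋃₀ c) := by
      refine ⟨?_, ?_, ?_⟩
      · obtain ⟨G, hG⟩ := hne
        exact ⟨1, G, hG, hx_one_mem (hc hG).1⟩
      · rintro a b ⟨G, hG, ha⟩ ⟨H, hH, hb⟩
        rcases hch.total hG hH with h | h
        · exact ⟨H, hH, (hc hH).1.2.1 _ _ (h ha) hb⟩
        · exact ⟨G, hG, (hc hG).1.2.1 _ _ ha (h hb)⟩
      · rintro a b ⟨G, hG, ha⟩ hab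
        exact ⟨G, hG, (hc hG).1.2.2 _ _ ha hab⟩
    refine ⟨⋃₀ c, ⟨hfil, (hx_proper hfil).2 ?_⟩, fun s hs => Set.subset_sUnion_of_mem hs⟩
    rintro ⟨G, hG, hbG⟩
    exact (hx_proper (hc hG).1).1 (hc hG).2 hbG) F ⟨hF, (hx_proper hF).2 hb⟩
  refine ⟨M, ⟨hM.prop, fun G hG hMG => ?_⟩, hFM⟩
  exact Set.Subset.antisymm (hM.le_of_ge hG hMG) hMG

theorem hx_max_bot {M : Set A} (hM : IsMaxRLFilter M) : (⊥ : A) ∉ M :=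
  (hx_proper hM.1.1).1 hM.1.2

theorem hx_max_contra {M : Set A} (hM : IsMaxRLFilter M) {a : A} (h : a ∈ M)
    (k : rneg a ∈ M) : False :=
  hx_max_bot hM (hM.1.1.2.2 _ _ (hM.1.1.2.1 _ _ h k) (hx_mul_neg a))

theorem hx_ext {G X : Set A} (hG : IsRLFilter G) (hX : IsRLFilter X) :
    (∃ e : A, IsBoolElem e ∧ e ∈ G ∧ rneg e ∈ X) ∨
    ∃ M : Set A, IsMaxRLFilter M ∧ G ⊆ M ∧ ∀ e : A, IsBoolElem e → rneg e ∈ X → rneg e ∈ M := by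
  have hbot : IsBoolElem (⊥ : A) := ⟨⊤, by simp, by simp⟩
  have hnbot : rneg (⊥ : A) ∈ X :=
    hX.2.2 _ _ (hx_one_mem hX) (hx_le_neg (by simp))
  let K : Set A := {x | ∃ e : A, IsBoolElem e ∧ rneg e ∈ X ∧ e ⊔ x ∈ G}
  have hGK : G ⊆ K := fun x hx => ⟨⊥, hbot, hnbot, by simpa using hx⟩
  have hK : IsRLFilter K := by
    refine ⟨⟨1, hGK (hx_one_mem hG)⟩, ?_, ?_⟩
    · rintro a b ⟨e, he, he', hea⟩ ⟨f, hf, hf', hfb⟩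
      exact ⟨e ⊔ f, hx_bool_sup he hf, hX.2.2 _ _ (hX.2.1 _ _ he' hf') (hx_negmul e f),
        hG.2.2 _ _ (hG.2.1 _ _ hea hfb) (hx_sup_mul_sup _ _ _ _)⟩
    · rintro a b ⟨e, he, he', hea⟩ hab
      exact ⟨e, he, he', hG.2.2 _ _ hea (sup_le_sup_left hab _)⟩
  by_cases hb : (⊥ : A) ∈ K
  · obtain ⟨e, he, he', h⟩ := hb
    exact Or.inl ⟨e, he, by simpa using h, he'⟩
  · obtain ⟨M, hM, hKM⟩ := hx_exists_max hK hb
    refine Or.inr ⟨M, hM, hGK.trans hKM, fun e he he' => hKM ⟨e, he, he', ?_⟩⟩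
    rw [(hx_bool_iff e).1 he, ← one_eq_top]
    exact hx_one_mem hG

theorem hx_sep {G H : Set A} (hG : IsRLFilter G) (hH : IsRLFilter H)
    (h : ∀ M N : Set A, IsMaxRLFilter M → IsMaxRLFilter N → G ⊆ M → H ⊆ N →
      ∃ e : A, IsBoolElem e ∧ e ∈ M ∧ rneg e ∈ N) :
    ∃ e : A, IsBoolElem e ∧ e ∈ G ∧ rneg e ∈ H := by
  rcases hx_ext hH hG with ⟨b, hb, hbH, hbG⟩ | ⟨N, hN, hHN, hNe⟩
  · exact ⟨rneg b, hx_bool_neg hb, hbG, hH.2.2 _ _ hbH (hx_le_negneg b)⟩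
  · rcases hx_ext hG hN.1.1 with ⟨e, he, heG, heN⟩ | ⟨M, hM, hGM, hMe⟩
    · exact (hx_max_contra hN heN
        (hNe (rneg e) (hx_bool_neg he) (hG.2.2 _ _ heG (hx_le_negneg e)))).elim
    · obtain ⟨e, he, heM, heN⟩ := h M N hM hN hGM hHN
      exact (hx_max_contra hM heM (hMe e he heN)).elim

theorem hx_rimp_mem {F : Set A} (hF : IsRLFilter F) {a x : A} :
    rimp a x ∈ F ↔ ∃ f ∈ F, f * a ≤ x :=
  ⟨fun h => ⟨_, h, (residuation _ _ _).1 le_rfl⟩,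
    fun ⟨f, hf, h⟩ => hF.2.2 _ _ hf ((residuation _ _ _).2 h)⟩

theorem hx_inf_mem {F : Set A} (hF : IsRLFilter F) {a b : A} :
    a ⊓ b ∈ F ↔ a ∈ F ∧ b ∈ F :=
  ⟨fun h => ⟨hF.2.2 _ _ h inf_le_left, hF.2.2 _ _ h inf_le_right⟩,
    fun h => hF.2.2 _ _ (hF.2.1 _ _ h.1 h.2) (le_inf (hx_mul_left _ _) (hx_mul_right _ _))⟩

theorem hx_gen {F : Set A} (hF : IsRLFilter F) {a c : A} (hc : c ∈ F) (hac : a * c ≤ a * a) :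
    IsRLFilter {x : A | ∃ f ∈ F, f * a ≤ x} := by
  refine ⟨⟨1, 1, hx_one_mem hF, hx_le_one _⟩, ?_, ?_⟩
  · rintro x y ⟨f, hf, hx⟩ ⟨g, hg, hy⟩
    refine ⟨(f * g) * c, hF.2.1 _ _ (hF.2.1 _ _ hf hg) hc, ?_⟩
    calc f * g * c * a = (f * g) * (a * c) := by rw [mul_assoc, mul_comm c a]
      _ ≤ (f * g) * (a * a) := hx_mono le_rfl hac
      _ = (f * a) * (g * a) := mul_mul_mul_comm _ _ _ _
      _ ≤ x * y := hx_mono hx hy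
  · rintro x y ⟨f, hf, hx⟩ hxy
    exact ⟨f, hf, hx.trans hxy⟩

theorem hx_disjoint {M N : Set A} (hM : IsMaxRLFilter M) (hN : IsMaxRLFilter N) (hne : M ≠ N) :
    ∃ a ∈ M, ∃ b ∈ N, a * b ≤ ⊥ := by
  by_contra hcon
  let K : Set A := {x | ∃ a ∈ M, ∃ b ∈ N, a * b ≤ x}
  have hMK : M ⊆ K := fun x hx => ⟨x, hx, 1, hx_one_mem hN.1.1, by simp⟩
  have hNK : N ⊆ K := fun x hx => ⟨1, hx_one_mem hM.1.1, x, hx, by simp⟩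
  have hK : IsRLFilter K := by
    refine ⟨⟨1, hMK (hx_one_mem hM.1.1)⟩, ?_, ?_⟩
    · rintro x y ⟨a, ha, b, hb, h⟩ ⟨a', ha', b', hb', h'⟩
      refine ⟨a * a', hM.1.1.2.1 _ _ ha ha', b * b', hN.1.1.2.1 _ _ hb hb', ?_⟩
      rw [mul_mul_mul_comm]
      exact hx_mono h h'
    · rintro x y ⟨a, ha, b, hb, h⟩ hxy
      exact ⟨a, ha, b, hb, h.trans hxy⟩
  have hKp : IsProperRLFilter K := ⟨hK, (hx_proper hK).2 hcon⟩
  exact hne ((hM.2 K hKp hMK).symm.trans (hN.2 K hKp hNK))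

end ResiduatedLattice

open ResiduatedLattice in
theorem stmt_11 {A : Type*} [ResiduatedLattice A] :
    (∀ F : Set A, IsRLFilter F → HasBLP F) ↔
      (∀ M N : Set A, IsMaxRLFilter M → IsMaxRLFilter N → M ≠ N →
        ∃ e : A, IsBoolElem e ∧ e ∈ M ∧ rneg e ∈ N) := by
  constructor
  · intro h M N hM hN hne
    obtain ⟨a, ha, b, hb, hab⟩ := hx_disjoint hM hN hne
    have fM := hM.1.1
    have fN := hN.1.1
    have hna : rneg a ∈ N := fN.2.2 _ _ hb (hx_le_neg (by rwa [mul_comm]))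
    have hF : IsRLFilter (M ∩ N) :=
      ⟨⟨1, hx_one_mem fM, hx_one_mem fN⟩,
        fun x y hx hy => ⟨fM.2.1 _ _ hx.1 hy.1, fN.2.1 _ _ hx.2 hy.2⟩,
        fun x y hx hxy => ⟨fM.2.2 _ _ hx.1 hxy, fN.2.2 _ _ hx.2 hxy⟩⟩
    obtain ⟨e, he, hd⟩ := h _ hF a ⟨fM.2.2 _ _ ha le_sup_left, fN.2.2 _ _ hna le_sup_right⟩
    refine ⟨e, he, ?_, ?_⟩
    · obtain ⟨f, hf, hfa⟩ := (hx_rimp_mem fM).1 ((hx_inf_mem fM).1 hd.1).1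
      exact fM.2.2 _ _ (fM.2.1 _ _ hf ha) hfa
    · obtain ⟨f, hf, hfa⟩ := (hx_rimp_mem fN).1 ((hx_inf_mem fN).1 hd.2).2
      refine fN.2.2 _ _ (fN.2.1 _ _ hna hf) (hx_le_neg ?_)
      rw [mul_assoc]
      refine (hx_mono le_rfl hfa).trans ?_
      rw [mul_comm]; exact hx_mul_neg a
  · intro h F hF a ha
    have h1 : a * (a ⊔ rneg a) ≤ a * a :=
      (hx_mul_sup _ _ _).trans (sup_le le_rfl ((hx_mul_neg a).trans bot_le))
    have h2 : rneg a * (a ⊔ rneg a) ≤ rneg a * rneg a := by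
      refine (hx_mul_sup _ _ _).trans (sup_le ?_ le_rfl)
      rw [mul_comm]; exact (hx_mul_neg a).trans bot_le
    obtain ⟨e, he, ⟨f, hf, hfe⟩, ⟨g, hg, hge⟩⟩ := hx_sep (hx_gen hF ha h1) (hx_gen hF ha h2) (by
      intro M N hM hN hGM hHN
      refine h M N hM hN ?_
      rintro rfl
      exact hx_max_contra (a := a) hM (hGM ⟨1, hx_one_mem hF, by simp⟩) (hHN ⟨1, hx_one_mem hF, by simp⟩))
    refine ⟨e, he, (hx_inf_mem hF).2 ⟨(hx_rimp_mem hF).2 ⟨f, hf, hfe⟩, (hx_rimp_mem hF).2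
      ⟨g * (a ⊔ rneg a), hF.2.1 _ _ hg ha, ?_⟩⟩⟩
    have h3 : g * (a ⊔ rneg a) ≤ a ⊔ rneg e :=
      (hx_mul_sup _ _ _).trans (sup_le_sup (hx_mul_right _ _) hge)
    refine (hx_mono h3 le_rfl).trans ?_
    rw [mul_comm]
    exact (hx_mul_sup _ _ _).trans (sup_le (hx_mul_right _ _) ((hx_mul_neg e).trans bot_le))
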